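/- Let C be a preadditive monoidal category whose tensor product is additive in each variable, and let H be an object of C with a chosen right dual Hᘁ (coevaluation η_H : 𝟙 ⟶ H ⊗ Hᘁ). Let μ : H ⊗ H ⟶ H, ε : H ⟶ 𝟙, τ : H ⟶ H, and Λ : 𝟙 ⟶ H be morphisms with Λ ≠ 0 satisfying the right integral law (λ_H).inv ≫ (Λ ▷ H) ≫ μ = ε ≫ Λ. Suppose the pairing p := μ ≫ τ ≫ ε : H ⊗ H ⟶ 𝟙 is non-degenerate, in the sense that the induced morphism H ⟶ Hᘁ given by (ρ_H).inv ≫ (H ◁ η_H) ≫ (α_{H,H,Hᘁ}).inv ≫ (p ▷ Hᘁ) ≫ (λ_{Hᘁ}).hom is an isomorphism. Then Λ ≫ τ ≫ ε ≠ 0. -/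

import Mathlib

open CategoryTheory MonoidalCategory

theorem stmt4 {C : Type*} [Category C] [MonoidalCategory C]
    [Preadditive C] [MonoidalPreadditive C]
    (H : C) [HasRightDual H]
    (μ : H ⊗ H ⟶ H) (ε : H ⟶ 𝟙_ C) (τ : H ⟶ H) (Λ : 𝟙_ C ⟶ H)
    (hΛ : Λ ≠ 0)
    (hint : (λ_ H).inv ≫ (Λ ▷ H) ≫ μ = ε ≫ Λ)
    (hnd : IsIso ((ρ_ H).inv ≫ (H ◁ (η_ H Hᘁ)) ≫ (α_ H H (Hᘁ : C)).inv ≫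
      ((μ ≫ τ ≫ ε) ▷ (Hᘁ : C)) ≫ (λ_ (Hᘁ : C)).hom)) :
    Λ ≫ τ ≫ ε ≠ 0 := by
  intro h
  have hp : Λ ▷ H ≫ μ ≫ τ ≫ ε = 0 := by
    have hμ : Λ ▷ H ≫ μ = (λ_ H).hom ≫ ε ≫ Λ := by
      rw [← hint, Iso.hom_inv_id_assoc]
    rw [← Category.assoc, hμ, Category.assoc, Category.assoc, h, Limits.comp_zero, Limits.comp_zero]
  have hz : Λ ≫ ((ρ_ H).inv ≫ (H ◁ (η_ H Hᘁ)) ≫ (α_ H H (Hᘁ : C)).inv ≫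
      ((μ ≫ τ ≫ ε) ▷ (Hᘁ : C)) ≫ (λ_ (Hᘁ : C)).hom) = 0 := by
    rw [rightUnitor_inv_naturality_assoc, ← whisker_exchange_assoc,
      associator_inv_naturality_left_assoc, ← comp_whiskerRight_assoc, hp,
      MonoidalPreadditive.zero_whiskerRight]
    simp only [Limits.zero_comp, Limits.comp_zero]
  exact hΛ ((cancel_mono _).1 (hz.trans Limits.zero_comp.symm))
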